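/- Let φ : ℂ* → ℂ* be a conjugating mapping (a bijection such that for every holomorphic f : ℂ* → ℂ* the map φ ∘ f ∘ φ⁻¹ is holomorphic) with φ(1) = 1. Then there exists c ∈ ℂ* such that either φ(exp(w)) = exp(c·φ(w)) for all w ∈ ℂ*, or φ(exp(w)) = exp(c/φ(w)) for all w ∈ ℂ*. -/

import Mathlib

open Complex Set

noncomputable section

noncomputable section

/-- The punctured complex line `ℂ* = ℂ ∖ {0}`. -/
def Cstar : Set ℂ := {z : ℂ | z ≠ 0}

/-- A holomorphic self-map of `ℂ*` (represented by a total function whose behaviour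
matters only on `ℂ*`). -/
def CstarEndo (f : ℂ → ℂ) : Prop :=
  DifferentiableOn ℂ f Cstar ∧ Set.MapsTo f Cstar Cstar

/-- A conjugating mapping of `ℂ*`: a bijection of `ℂ*` such that for every holomorphic
self-map `f` of `ℂ*` the conjugate `φ ∘ f ∘ φ⁻¹` is again a holomorphic self-map of `ℂ*`
(expressed as: there is a holomorphic self-map `g` with `g ∘ φ = φ ∘ f` on `ℂ*`). -/
def ConjugatingCstar (φ : ℂ → ℂ) : Prop :=
  Set.BijOn φ Cstar Cstar ∧
    ∀ f, CstarEndo f → ∃ g, CstarEndo g ∧ ∀ z ∈ Cstar, g (φ z) = φ (f z)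


open Filter Topology in
theorem aux_removable (h : ℂ → ℂ) (hd : ∀ z, z ≠ 0 → DifferentiableAt ℂ h z)
    (ht : Tendsto h (𝓝[≠] 0) (𝓝 0)) :
    ∃ C : ℝ, ∀ᶠ z in 𝓝[≠] (0:ℂ), ‖h z‖ ≤ C * ‖z‖ := by
  set H : ℂ → ℂ := Function.update h 0 0 with hH
  have hHd : AnalyticAt ℂ H 0 := by
    apply analyticAt_of_differentiable_on_punctured_nhds_of_continuousAt
    · filter_upwards [self_mem_nhdsWithin] with z hz
      have hz : z ≠ 0 := hz
      refine (hd z hz).congr_of_eventuallyEq ?_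
      filter_upwards [isOpen_ne.mem_nhds hz] with y hy
      exact Function.update_of_ne hy _ _
    · exact continuousAt_update_same.2 ht
  have := hHd.differentiableAt.isBigO_sub
  obtain ⟨C, hC⟩ := this.bound
  refine ⟨C, ?_⟩
  filter_upwards [nhdsWithin_le_nhds hC, self_mem_nhdsWithin] with z hz hz0
  have hz0 : z ≠ 0 := hz0
  simpa [hH, Function.update_of_ne hz0] using hz

structure AutPair (f g : ℂ → ℂ) : Prop where
  df : ∀ z, z ≠ 0 → DifferentiableAt ℂ f z
  dg : ∀ z, z ≠ 0 → DifferentiableAt ℂ g z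
  nf : ∀ z, z ≠ 0 → f z ≠ 0
  ng : ∀ z, z ≠ 0 → g z ≠ 0
  gf : ∀ z, z ≠ 0 → g (f z) = z
  fg : ∀ z, z ≠ 0 → f (g z) = z

theorem AutPair.symm {f g : ℂ → ℂ} (h : AutPair f g) : AutPair g f :=
  ⟨h.dg, h.df, h.ng, h.nf, h.fg, h.gf⟩

theorem AutPair.inv {f g : ℂ → ℂ} (h : AutPair f g) :
    AutPair (fun z => (f z)⁻¹) (fun z => g z⁻¹) where
  df z hz := (h.df z hz).inv (h.nf z hz)
  dg z hz := by
    have h1 := h.dg z⁻¹ (inv_ne_zero hz)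
    exact h1.comp z (differentiableAt_inv hz)
  nf z hz := inv_ne_zero (h.nf z hz)
  ng z hz := h.ng _ (inv_ne_zero hz)
  gf z hz := by simp [h.gf z hz]
  fg z hz := by simp [h.fg _ (inv_ne_zero hz)]

/-- away from annuli -/
theorem AutPair.avoid {f g : ℂ → ℂ} (h : AutPair f g) (a b : ℝ) (ha : 0 < a) :
    ∃ δ > 0, ∀ z : ℂ, z ≠ 0 → ‖z‖ < δ → ‖f z‖ < a ∨ b < ‖f z‖ := by
  have hK : IsCompact (Metric.closedBall (0:ℂ) b ∩ {w | a ≤ ‖w‖}) :=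
    (isCompact_closedBall _ _).inter_right (isClosed_le continuous_const continuous_norm)
  have hK0 : ∀ w ∈ (Metric.closedBall (0:ℂ) b ∩ {w | a ≤ ‖w‖}), w ≠ 0 := by
    rintro w ⟨_, hw⟩ rfl
    simp at hw; linarith
  have hI : IsCompact (g '' (Metric.closedBall (0:ℂ) b ∩ {w | a ≤ ‖w‖})) :=
    hK.image_of_continuousOn fun w hw => (h.dg w (hK0 w hw)).continuousAt.continuousWithinAt
  have h0 : (0:ℂ) ∈ (g '' (Metric.closedBall (0:ℂ) b ∩ {w | a ≤ ‖w‖}))ᶜ := by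
    rintro ⟨w, hw, hw'⟩
    exact h.ng w (hK0 w hw) hw'
  obtain ⟨δ, hδ, hb⟩ := Metric.isOpen_iff.1 hI.isClosed.isOpen_compl 0 h0
  refine ⟨δ, hδ, fun z hz hzd => ?_⟩
  by_contra! hc
  refine hb (a := z) (by simpa using hzd) ⟨f z, ⟨by simpa using hc.2, hc.1⟩, h.gf z hz⟩

open Filter Topology in
theorem AutPair.dich {f g : ℂ → ℂ} (h : AutPair f g) :
    Tendsto f (𝓝[≠] 0) (𝓝 0) ∨ Tendsto (fun z => (f z)⁻¹) (𝓝[≠] 0) (𝓝 0) := by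
  obtain ⟨δ, hδ, hh⟩ := h.avoid 1 1 one_pos
  -- punctured ball is connected
  have hconn : IsPreconnected {z : ℂ | z ≠ 0 ∧ ‖z‖ < δ} := by
    have hE : {z : ℂ | z ≠ 0 ∧ ‖z‖ < δ} = Complex.exp '' {w : ℂ | w.re < Real.log δ} := by
      ext z
      constructor
      · rintro ⟨hz, hzd⟩
        refine ⟨Complex.log z, ?_, Complex.exp_log hz⟩
        rw [Set.mem_ofPred_eq, Complex.log_re]
        exact Real.log_lt_log (norm_pos_iff.2 hz) hzd
      · rintro ⟨w, hw, rfl⟩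
        refine ⟨Complex.exp_ne_zero _, ?_⟩
        rw [Complex.norm_exp]
        exact (Real.lt_log_iff_exp_lt hδ).1 hw
    rw [hE]
    exact (convex_halfSpace_re_lt _).isPreconnected.image _ Complex.continuous_exp.continuousOn
  have hcont : ContinuousOn (fun z => ‖f z‖) {z : ℂ | z ≠ 0 ∧ ‖z‖ < δ} := fun z hz =>
    (h.df z hz.1).continuousAt.norm.continuousWithinAt
  have hor : (∀ z : ℂ, z ≠ 0 → ‖z‖ < δ → ‖f z‖ < 1) ∨ (∀ z : ℂ, z ≠ 0 → ‖z‖ < δ → 1 < ‖f z‖) := by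
    by_contra! hc
    obtain ⟨⟨x, hx, hxd, hx1⟩, ⟨y, hy, hyd, hy1⟩⟩ := hc
    have := hconn.intermediate_value (a := y) (b := x) ⟨hy, hyd⟩ ⟨hx, hxd⟩ hcont ⟨hy1, hx1⟩
    obtain ⟨z, hz, hz1⟩ := this
    have := hh z hz.1 hz.2
    simp only at hz1
    rcases this with h | h <;> linarith
  rcases hor with hs | hs
  · left
    rw [Metric.tendsto_nhdsWithin_nhds]
    intro ε hε
    obtain ⟨η, hη, hh'⟩ := h.avoid ε 1 hε
    refine ⟨min δ η, lt_min hδ hη, fun z hz hzd => ?_⟩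
    have hz : z ≠ 0 := hz
    simp only [dist_zero_right, lt_min_iff] at hzd ⊢
    rcases hh' z hz hzd.2 with h | h
    · exact h
    · have := hs z hz hzd.1; linarith
  · right
    rw [Metric.tendsto_nhdsWithin_nhds]
    intro ε hε
    obtain ⟨η, hη, hh'⟩ := h.avoid 1 ε⁻¹ one_pos
    refine ⟨min δ η, lt_min hδ hη, fun z hz hzd => ?_⟩
    have hz : z ≠ 0 := hz
    simp only [dist_zero_right, lt_min_iff, norm_inv] at hzd ⊢
    rcases hh' z hz hzd.2 with h | h
    · have := hs z hz hzd.1; linarith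
    · exact inv_lt_of_inv_lt₀ hε h

open Filter Topology in
theorem not_tendsto_inv (h : Tendsto (fun z : ℂ => z⁻¹) (𝓝[≠] 0) (𝓝 0)) : False := by
  have h2 : Tendsto (fun z : ℂ => z) (𝓝[≠] 0) (𝓝 0) := nhdsWithin_le_nhds
  have h3 := h.mul h2
  have h4 : Tendsto (fun z : ℂ => z⁻¹ * z) (𝓝[≠] 0) (𝓝 1) := by
    refine tendsto_const_nhds.congr' ?_
    filter_upwards [self_mem_nhdsWithin] with z hz
    exact (inv_mul_cancel₀ hz).symm
  have := tendsto_nhds_unique h3 h4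
  simp at this

open Filter Topology in
theorem AutPair.lin {f g : ℂ → ℂ} (h : AutPair f g) (hf : Tendsto f (𝓝[≠] 0) (𝓝 0)) :
    ∃ α : ℂ, ∀ z, z ≠ 0 → f z = α * z := by
  have hf' : Tendsto f (𝓝[≠] 0) (𝓝[≠] 0) := by
    refine tendsto_nhdsWithin_iff.2 ⟨hf, ?_⟩
    filter_upwards [self_mem_nhdsWithin] with z hz
    exact h.nf z hz
  have hg : Tendsto g (𝓝[≠] 0) (𝓝 0) := by
    rcases h.symm.dich with hg | hg
    · exact hg
    · exfalso
      apply not_tendsto_inv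
      refine (hg.comp hf').congr' ?_
      filter_upwards [self_mem_nhdsWithin] with z hz
      simp [h.gf z hz]
  have h1 : AutPair (fun z => f z⁻¹) (fun z => (g z)⁻¹) := h.symm.inv.symm
  have h2 := h1.inv
  have hf1 : Tendsto (fun z => (f z⁻¹)⁻¹) (𝓝[≠] 0) (𝓝 0) := by
    rcases h1.dich with hk | hk
    · exfalso
      have hk' : Tendsto (fun z => f z⁻¹) (𝓝[≠] 0) (𝓝[≠] 0) := by
        refine tendsto_nhdsWithin_iff.2 ⟨hk, ?_⟩
        filter_upwards [self_mem_nhdsWithin] with z hz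
        exact h.nf _ (inv_ne_zero hz)
      apply not_tendsto_inv
      refine (hg.comp hk').congr' ?_
      filter_upwards [self_mem_nhdsWithin] with z hz
      simp [h.gf _ (inv_ne_zero hz)]
    · exact hk
  obtain ⟨C1, hC1⟩ := aux_removable _ h2.df hf1
  obtain ⟨C2, hC2⟩ := aux_removable _ h.dg hg
  have hC2' := hf'.eventually hC2
  rw [eventually_nhdsWithin_iff, Metric.eventually_nhds_iff] at hC1 hC2'
  obtain ⟨δ1, hδ1, hC1⟩ := hC1
  obtain ⟨δ2, hδ2, hC2'⟩ := hC2'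
  -- middle compact
  have hK : IsCompact (Metric.closedBall (0:ℂ) δ1⁻¹ ∩ {w | δ2 ≤ ‖w‖}) :=
    (isCompact_closedBall _ _).inter_right (isClosed_le continuous_const continuous_norm)
  have hq : ∀ z, z ≠ 0 → DifferentiableAt ℂ (fun z => z / f z) z := fun z hz =>
    differentiableAt_id.div (h.df z hz) (h.nf z hz)
  obtain ⟨C3, hC3⟩ := hK.exists_bound_of_continuousOn (f := fun z => z / f z) (by
    rintro z ⟨_, hz⟩
    have hz0 : z ≠ 0 := by
      rintro rfl
      simp at hz; linarith
    exact (hq z hz0).continuousAt.continuousWithinAt)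
  have hbd : ∀ z, z ≠ 0 → ‖z / f z‖ ≤ max C1 (max C2 C3) := by
    intro z hz
    have hzp : 0 < ‖z‖ := norm_pos_iff.2 hz
    have hfp : 0 < ‖f z‖ := norm_pos_iff.2 (h.nf z hz)
    by_cases hA : ‖z‖ < δ2
    · have := hC2' (y := z) (by simpa using hA) hz
      rw [h.gf z hz] at this
      refine le_trans ?_ (le_trans (le_max_left _ _) (le_max_right _ _))
      rw [norm_div, div_le_iff₀ hfp]
      exact this
    by_cases hB : δ1⁻¹ < ‖z‖
    · have := hC1 (y := z⁻¹) (by simpa using inv_lt_of_inv_lt₀ hδ1 hB) (inv_ne_zero hz)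
      refine le_trans ?_ (le_max_left _ _)
      simp only [inv_inv, norm_inv] at this
      rw [← div_eq_mul_inv, le_div_iff₀ hzp] at this
      rw [norm_div, div_eq_inv_mul]
      exact this
    · refine le_trans (hC3 z ⟨by simpa using hB, ?_⟩) (le_trans (le_max_right _ _) (le_max_right _ _))
      simpa using hA
  have hE : Differentiable ℂ (fun w => Complex.exp w / f (Complex.exp w)) := fun w =>
    (hq (Complex.exp w) (Complex.exp_ne_zero w)).comp w Complex.differentiableAt_exp
  have hconst := fun w => hE.apply_eq_apply_of_bounded (by
    rw [isBounded_iff_forall_norm_le]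
    refine ⟨max C1 (max C2 C3), ?_⟩
    · rintro _ ⟨w, rfl⟩
      exact hbd _ (Complex.exp_ne_zero w)) w 0
  refine ⟨f 1, fun z hz => ?_⟩
  have := hconst (Complex.log z)
  simp only [Complex.exp_log hz, Complex.exp_zero] at this
  rw [div_eq_div_iff (h.nf z hz) (h.nf 1 one_ne_zero)] at this
  linear_combination -this

theorem AutPair.classify {f g : ℂ → ℂ} (h : AutPair f g) :
    ∃ α : ℂ, (∀ z, z ≠ 0 → f z = α * z) ∨ (∀ z, z ≠ 0 → f z = α / z) := by
  rcases h.dich with hf | hf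
  · obtain ⟨α, hα⟩ := h.lin hf
    exact ⟨α, Or.inl hα⟩
  · obtain ⟨α, hα⟩ := h.inv.lin hf
    refine ⟨α⁻¹, Or.inr fun z hz => ?_⟩
    have := hα z hz
    rw [← inv_inv (f z), this, mul_inv, div_eq_mul_inv]

theorem endo_diff {f : ℂ → ℂ} (h : CstarEndo f) (z : ℂ) (hz : z ≠ 0) : DifferentiableAt ℂ f z :=
  h.1.differentiableAt (isOpen_ne.mem_nhds hz)

theorem conj_map_mul (φ : ℂ → ℂ) (hφ : ConjugatingCstar φ) (h1 : φ 1 = 1) (a z : ℂ)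
    (ha : a ≠ 0) (hz : z ≠ 0) : φ (a * z) = φ a * φ z := by
  obtain ⟨hb, hc⟩ := hφ
  have hmul : ∀ b : ℂ, b ≠ 0 → CstarEndo (fun z => b * z) := fun b hb =>
    ⟨(differentiable_id.const_mul b).differentiableOn, fun z hz => mul_ne_zero hb hz⟩
  obtain ⟨b, hbb⟩ := IsAlgClosed.exists_pow_nat_eq a (n := 2) two_pos
  rw [sq] at hbb
  subst hbb
  have hb0 : b ≠ 0 := by rintro rfl; simp at ha
  obtain ⟨f, hf, hf'⟩ := hc _ (hmul b hb0)
  obtain ⟨g, hg, hg'⟩ := hc _ (hmul b⁻¹ (inv_ne_zero hb0))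
  have hP : AutPair f g := by
    refine ⟨endo_diff hf, endo_diff hg, fun z hz => hf.2 hz, fun z hz => hg.2 hz, ?_, ?_⟩
    · intro z hz
      obtain ⟨w, hw, rfl⟩ := hb.surjOn hz
      rw [hf' w hw, hg' _ (mul_ne_zero hb0 hw), inv_mul_cancel_left₀ hb0]
    · intro z hz
      obtain ⟨w, hw, rfl⟩ := hb.surjOn hz
      rw [hg' w hw, hf' _ (mul_ne_zero (inv_ne_zero hb0) hw), mul_inv_cancel_left₀ hb0]
  have hff : ∀ z, z ≠ 0 → f (f (φ z)) = φ (b * b * z) := fun z hz => by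
    rw [hf' z hz, hf' _ (mul_ne_zero hb0 hz), mul_assoc]
  have hφ0 : ∀ z, z ≠ 0 → φ z ≠ 0 := fun z hz => hb.mapsTo hz
  have key : ∃ c : ℂ, ∀ z, z ≠ 0 → φ (b * b * z) = c * φ z := by
    obtain ⟨α, hα | hα⟩ := hP.classify
    · refine ⟨α * α, fun z hz => ?_⟩
      rw [← hff z hz, hα _ (hP.nf _ (hφ0 z hz)), hα _ (hφ0 z hz), mul_assoc]
    · refine ⟨1, fun z hz => ?_⟩
      have h2 := hP.nf _ (hφ0 z hz)
      rw [← hff z hz, hα _ h2]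
      rw [hα _ (hφ0 z hz)] at h2 ⊢
      have hα0 : α ≠ 0 := by rintro rfl; simp at h2
      have := hφ0 z hz
      field_simp
  obtain ⟨c, hc⟩ := key
  have := hc 1 one_ne_zero
  rw [mul_one, h1, mul_one] at this
  rw [hc z hz, this]

open Filter Topology in
theorem scal_monomial (L : ℂ → ℂ) (μ : ℂ) (hμ : 1 < ‖μ‖)
    (hd : ∀ z, z ≠ 0 → DifferentiableAt ℂ L z) (h0 : L 0 = 0)
    (hL : ∀ z, z ≠ 0 → L (μ * z) = 2 * L z) :
    ∃ (a : ℂ) (k : ℕ), 0 < k ∧ ∀ z, z ≠ 0 → L z = a * z ^ k := by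
  have hμ0 : μ ≠ 0 := by rintro rfl; simp at hμ; linarith
  have hLj : ∀ (j : ℕ) z, z ≠ 0 → L (μ ^ j * z) = 2 ^ j * L z := by
    intro j
    induction j with
    | zero => intro z hz; simp
    | succ j ih =>
      intro z hz
      rw [pow_succ, mul_assoc, ih _ (mul_ne_zero hμ0 hz), hL z hz]; ring
  -- continuity at 0
  have hK : IsCompact (Metric.closedBall (0:ℂ) ‖μ‖ ∩ {w | 1 ≤ ‖w‖}) :=
    (isCompact_closedBall _ _).inter_right (isClosed_le continuous_const continuous_norm)
  obtain ⟨M, hM⟩ := hK.exists_bound_of_continuousOn (f := L) (by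
    rintro z ⟨_, hz⟩
    have hz0 : z ≠ 0 := by
      rintro rfl
      simp at hz; linarith
    exact (hd z hz0).continuousAt.continuousWithinAt)
  have hcont : ContinuousAt L 0 := by
    rw [Metric.continuousAt_iff]
    intro ε hε
    obtain ⟨N, hN⟩ := pow_unbounded_of_one_lt (M / ε) (one_lt_two)
    have hμN : 0 < ‖μ‖ ^ N := by positivity
    have hμN1 : 1 ≤ ‖μ‖ ^ N := one_le_pow₀ hμ.le
    refine ⟨(‖μ‖ ^ N)⁻¹, by positivity, fun {z} hz => ?_⟩
    rw [h0]
    simp only [dist_zero_right] at hz ⊢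
    by_cases hz0 : z = 0
    · simpa [hz0, h0] using hε
    have hzp : 0 < ‖z‖ := norm_pos_iff.2 hz0
    have hx : ‖μ‖ ^ N < ‖z‖⁻¹ := by rwa [lt_inv_comm₀ hμN hzp]
    obtain ⟨n, hn1, hn2⟩ := exists_nat_pow_near (hμN1.trans hx.le) hμ
    have hNn : N < n + 1 := (pow_lt_pow_iff_right₀ hμ).1 (hx.trans hn2)
    have hb := hM (μ ^ (n+1) * z) ⟨by
      simp only [mem_closedBall_zero_iff, norm_mul, norm_pow, pow_succ]
      rw [le_inv_comm₀ (by positivity) hzp] at hn1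
      calc ‖μ‖ ^ n * ‖μ‖ * ‖z‖ ≤ ‖μ‖ ^ n * ‖μ‖ * (‖μ‖ ^ n)⁻¹ := by gcongr
        _ = ‖μ‖ := by field_simp, by
      change 1 ≤ ‖μ ^ (n+1) * z‖
      rw [norm_mul, norm_pow]
      rw [inv_lt_iff_one_lt_mul₀ hzp] at hn2
      linarith⟩
    rw [hLj _ _ hz0, norm_mul, norm_pow, Complex.norm_ofNat] at hb
    have h2 : (2:ℝ) ^ N ≤ 2 ^ (n+1) := pow_le_pow_right₀ one_le_two hNn.le
    rw [div_lt_iff₀ hε] at hN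
    by_contra! hc
    have : (2:ℝ) ^ N * ε ≤ 2 ^ (n+1) * ‖L z‖ := by gcongr
    linarith
  have han : AnalyticAt ℂ L 0 := by
    apply analyticAt_of_differentiable_on_punctured_nhds_of_continuousAt _ hcont
    filter_upwards [self_mem_nhdsWithin] with z hz
    exact hd z hz
  -- scaling to zero
  have hto : ∀ z : ℂ, Tendsto (fun j : ℕ => (μ⁻¹) ^ j * z) atTop (𝓝 0) := by
    intro z
    have : Tendsto (fun j : ℕ => (μ⁻¹) ^ j) atTop (𝓝 0) :=
      tendsto_pow_atTop_nhds_zero_of_norm_lt_one (by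
        rw [norm_inv]; exact inv_lt_one_of_one_lt₀ hμ)
    simpa using this.mul_const z
  have hLinv : ∀ (j : ℕ) z, z ≠ 0 → L z = 2 ^ j * L ((μ⁻¹) ^ j * z) := by
    intro j z hz
    rw [← hLj j _ (mul_ne_zero (pow_ne_zero _ (inv_ne_zero hμ0)) hz), ← mul_assoc, ← mul_pow,
      mul_inv_cancel₀ hμ0, one_pow, one_mul]
  by_cases hz : ∀ᶠ z in 𝓝 (0:ℂ), L z = 0
  · refine ⟨0, 1, one_pos, fun z hz0 => ?_⟩
    obtain ⟨j, hj⟩ := ((hto z).eventually hz).exists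
    rw [hLinv j z hz0, hj]; simp
  · obtain ⟨k, u, hu, hu0, hev⟩ := han.exists_eventuallyEq_pow_smul_nonzero_iff.2 hz
    simp only [sub_zero, smul_eq_mul] at hev
    have hk : 0 < k := by
      rcases Nat.eq_zero_or_pos k with rfl | h
      · have := hev.self_of_nhds
        simp [h0] at this
        exact absurd this.symm hu0
      · exact h
    have hcu : ContinuousAt u 0 := hu.continuousAt
    have hne : (𝓝[≠] (0:ℂ)).NeBot := inferInstance
    -- u (μ z) μ^k = 2 u z near zero
    have hmt : Tendsto (fun z : ℂ => μ * z) (𝓝 0) (𝓝 0) := by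
      have : Continuous (fun z : ℂ => μ * z) := by fun_prop
      simpa using this.tendsto 0
    have hμk : μ ^ k = 2 := by
      have hA : Tendsto (fun z => μ ^ k * u (μ * z)) (𝓝[≠] 0) (𝓝 (μ ^ k * u 0)) :=
        ((hcu.tendsto.comp hmt).const_mul _).mono_left nhdsWithin_le_nhds
      have hB : Tendsto (fun z => 2 * u z) (𝓝[≠] 0) (𝓝 (2 * u 0)) :=
        (hcu.tendsto.const_mul _).mono_left nhdsWithin_le_nhds
      have hAB : (fun z => μ ^ k * u (μ * z)) =ᶠ[𝓝[≠] 0] (fun z => 2 * u z) := by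
        filter_upwards [nhdsWithin_le_nhds hev, nhdsWithin_le_nhds (hmt.eventually hev),
          self_mem_nhdsWithin] with z h1 h2 h3
        have h3 : z ≠ 0 := h3
        rw [hL z h3, h1, mul_pow] at h2
        have : z ^ k ≠ 0 := pow_ne_zero _ h3
        apply mul_left_cancel₀ this
        linear_combination -h2
      have := tendsto_nhds_unique (hA.congr' hAB) hB
      exact mul_right_cancel₀ hu0 this
    refine ⟨u 0, k, hk, fun z hz0 => ?_⟩
    have hT : Tendsto (fun j : ℕ => z ^ k * u ((μ⁻¹) ^ j * z)) atTop (𝓝 (z ^ k * u 0)) :=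
      (hcu.tendsto.comp (hto z)).const_mul _
    have hT2 : Tendsto (fun j : ℕ => z ^ k * u ((μ⁻¹) ^ j * z)) atTop (𝓝 (L z)) := by
      refine tendsto_const_nhds.congr' ?_
      filter_upwards [(hto z).eventually hev] with j hj
      rw [hLinv j z hz0, hj, mul_pow, ← pow_mul, mul_comm j k, pow_mul, inv_pow, hμk, inv_pow]
      field_simp
    rw [tendsto_nhds_unique hT2 hT, mul_comm]

structure Sit (φ g : ℂ → ℂ) : Prop where
  one : φ 1 = 1
  mul : ∀ a z, a ≠ 0 → z ≠ 0 → φ (a * z) = φ a * φ z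
  inj : ∀ a b, a ≠ 0 → b ≠ 0 → φ a = φ b → a = b
  sur : ∀ z, z ≠ 0 → ∃ w, w ≠ 0 ∧ φ w = z
  nz : ∀ z, z ≠ 0 → φ z ≠ 0
  dg : ∀ z, z ≠ 0 → DifferentiableAt ℂ g z
  ng : ∀ z, z ≠ 0 → g z ≠ 0
  conj : ∀ w, w ≠ 0 → g (φ w) = φ (Complex.exp w)

theorem Sit.gsq {φ g : ℂ → ℂ} (h : Sit φ g) (z : ℂ) (hz : z ≠ 0) : g (φ 2 * z) = g z ^ 2 := by
  obtain ⟨w, hw, rfl⟩ := h.sur z hz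
  rw [← h.mul _ _ two_ne_zero hw, h.conj _ (mul_ne_zero two_ne_zero hw), h.conj w hw, two_mul,
    Complex.exp_add, h.mul _ _ (Complex.exp_ne_zero _) (Complex.exp_ne_zero _), sq]

theorem Sit.gsur {φ g : ℂ → ℂ} (h : Sit φ g) (v : ℂ) (hv : v ≠ 0) : ∃ z, z ≠ 0 ∧ g z = v := by
  obtain ⟨y, hy, rfl⟩ := h.sur v hv
  by_cases hl : Complex.log y = 0
  · refine ⟨φ (2 * Real.pi * Complex.I), h.nz _ Complex.two_pi_I_ne_zero, ?_⟩
    rw [h.conj _ Complex.two_pi_I_ne_zero, Complex.exp_two_pi_mul_I, ← Complex.exp_log hy, hl,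
      Complex.exp_zero]
  · exact ⟨φ (Complex.log y), h.nz _ hl, by rw [h.conj _ hl, Complex.exp_log hy]⟩

theorem Sit.norm_ne_one {φ g : ℂ → ℂ} (h : Sit φ g) : ‖φ 2‖ ≠ 1 := by
  intro hμ
  obtain ⟨z, hz, hgz⟩ := h.gsur 2 two_ne_zero
  have hμ0 : φ 2 ≠ 0 := h.nz 2 two_ne_zero
  have hj : ∀ j : ℕ, g (φ 2 ^ j * z) = 2 ^ (2 ^ j) := by
    intro j
    induction j with
    | zero => simp [hgz]
    | succ j ih =>
      rw [pow_succ', mul_assoc, h.gsq _ (mul_ne_zero (pow_ne_zero _ hμ0) hz), ih, ← pow_mul,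
        pow_succ]
  obtain ⟨M, hM⟩ := (isCompact_sphere (0:ℂ) ‖z‖).exists_bound_of_continuousOn (f := g) (by
    intro y hy
    have hy0 : y ≠ 0 := by
      rintro rfl
      simp at hy
      exact hz (norm_eq_zero.1 hy.symm)
    exact (h.dg y hy0).continuousAt.continuousWithinAt)
  obtain ⟨N, hN⟩ := pow_unbounded_of_one_lt M (one_lt_two)
  have := hM (φ 2 ^ N * z) (by simp [hμ])
  rw [hj N, norm_pow, Complex.norm_ofNat] at this
  have h2 : (2:ℝ) ^ N ≤ 2 ^ (2 ^ N) := pow_le_pow_right₀ one_le_two Nat.lt_two_pow_self.le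
  linarith

open Filter Topology in
theorem Sit.main {φ g : ℂ → ℂ} (h : Sit φ g) (hμ : 1 < ‖φ 2‖) :
    ∃ c : ℂ, c ≠ 0 ∧ ∀ w, w ≠ 0 → φ (Complex.exp w) = Complex.exp (c * φ w) := by
  have hμ0 : φ 2 ≠ 0 := h.nz 2 two_ne_zero
  have hdd : ∀ z, z ≠ 0 → DifferentiableAt ℂ (deriv g) z := by
    intro z hz
    have : DifferentiableOn ℂ g {z | z ≠ 0} := fun z hz => (h.dg z hz).differentiableWithinAt
    exact (this.deriv isOpen_ne).differentiableAt (isOpen_ne.mem_nhds hz)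
  obtain ⟨a, k, hk, hL⟩ := scal_monomial (fun z => z * deriv g z / g z) (φ 2) hμ
    (fun z hz => (differentiableAt_id.mul (hdd z hz)).div (h.dg z hz) (h.ng z hz)) (by simp)
    (by
      intro z hz
      have hz2 := mul_ne_zero hμ0 hz
      have hA : HasDerivAt (fun z => g (φ 2 * z)) (deriv g (φ 2 * z) * (φ 2 * 1)) z :=
        HasDerivAt.comp z (h.dg _ hz2).hasDerivAt ((hasDerivAt_id z).const_mul (φ 2))
      have hB : HasDerivAt (fun z => g z ^ 2) (2 * g z ^ 1 * deriv g z) z := by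
        simpa using (h.dg z hz).hasDerivAt.fun_pow 2
      have hAB : (fun z => g (φ 2 * z)) =ᶠ[𝓝 z] (fun z => g z ^ 2) := by
        filter_upwards [isOpen_ne.mem_nhds hz] with y hy
        exact h.gsq y hy
      have := hA.unique (hB.congr_of_eventuallyEq hAB)
      have hgz := h.ng z hz
      rw [h.gsq z hz]
      field_simp
      linear_combination this)
  have hk0 : (k:ℂ) ≠ 0 := by exact_mod_cast hk.ne'
  set c := a / k with hc
  have hder : ∀ w, HasDerivAt (fun w => g (Complex.exp w) * Complex.exp (-(c * Complex.exp w ^ k)))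
      0 w := by
    intro w
    have he := Complex.exp_ne_zero w
    have hA : HasDerivAt (fun w => g (Complex.exp w)) (deriv g (Complex.exp w) * Complex.exp w) w :=
      HasDerivAt.comp w (h.dg _ he).hasDerivAt (Complex.hasDerivAt_exp w)
    have hB := (((Complex.hasDerivAt_exp w).fun_pow k).const_mul c).fun_neg.cexp
    have hC := hA.fun_mul hB
    refine hC.congr_deriv ?_
    have h1 := hL _ he
    rw [div_eq_iff (h.ng _ he)] at h1
    have h2 : Complex.exp w ^ k = Complex.exp w ^ (k-1) * Complex.exp w := by
      rw [← pow_succ, Nat.sub_add_cancel hk]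
    have h3 : c * k = a := by rw [hc]; field_simp
    generalize Complex.exp (-(c * Complex.exp w ^ k)) = E
    rw [h2] at h1
    linear_combination E * h1 - E * g (Complex.exp w) * Complex.exp w ^ (k-1) * Complex.exp w * h3
  obtain ⟨D, hD⟩ : ∃ D, ∀ z, z ≠ 0 → g z = D * Complex.exp (c * z ^ k) := by
    refine ⟨g 1 * Complex.exp (-c), fun z hz => ?_⟩
    have := is_const_of_deriv_eq_zero (fun w => (hder w).differentiableAt) (fun w => (hder w).deriv)
      (Complex.log z) 0
    simp only [Complex.exp_log hz, Complex.exp_zero, one_pow, mul_one] at this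
    rw [← this, mul_assoc, ← Complex.exp_add]
    simp
  have hμz : ∀ z, z ≠ 0 → D * Complex.exp (c * (φ 2 * z) ^ k) = D * D * Complex.exp (2 * (c * z ^ k)) := by
    intro z hz
    have := h.gsq z hz
    rw [hD z hz, hD _ (mul_ne_zero hμ0 hz)] at this
    rw [this, two_mul, Complex.exp_add]; ring
  have hD0 : D ≠ 0 := by
    intro hD'
    have := hD 1 one_ne_zero
    rw [hD', zero_mul] at this
    exact h.ng 1 one_ne_zero this
  have hD1 : D = 1 := by
    have hA : Tendsto (fun z => D * Complex.exp (c * (φ 2 * z) ^ k)) (𝓝[≠] 0) (𝓝 D) := by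
      have : Continuous (fun z => D * Complex.exp (c * (φ 2 * z) ^ k)) := by fun_prop
      have := this.tendsto 0
      simp [hk.ne'] at this
      exact this.mono_left nhdsWithin_le_nhds
    have hB : Tendsto (fun z => D * D * Complex.exp (2 * (c * z ^ k))) (𝓝[≠] 0) (𝓝 (D * D)) := by
      have : Continuous (fun z => D * D * Complex.exp (2 * (c * z ^ k))) := by fun_prop
      have := this.tendsto 0
      simp [hk.ne'] at this
      exact this.mono_left nhdsWithin_le_nhds
    have hAB : (fun z => D * Complex.exp (c * (φ 2 * z) ^ k)) =ᶠ[𝓝[≠] 0]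
        (fun z => D * D * Complex.exp (2 * (c * z ^ k))) := by
      filter_upwards [self_mem_nhdsWithin] with z hz
      exact hμz z hz
    have := tendsto_nhds_unique (hA.congr' hAB) hB
    exact mul_left_cancel₀ hD0 (by rw [← this, mul_one])
  subst hD1
  simp only [one_mul] at hD
  have hc0 : c ≠ 0 := by
    intro hc'
    obtain ⟨z, hz, hgz⟩ := h.gsur 2 two_ne_zero
    rw [hD z hz, hc', zero_mul, Complex.exp_zero] at hgz
    norm_num at hgz
  -- roots of unity
  have hprim := Complex.isPrimitiveRoot_exp k hk.ne'
  set ζ := Complex.exp (2 * Real.pi * Complex.I / k) with hζ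
  have hζ0 : ζ ≠ 0 := Complex.exp_ne_zero _
  obtain ⟨ω, hω, hωζ⟩ := h.sur ζ hζ0
  have hexp : ∀ w, w ≠ 0 → Complex.exp (ω * w) = Complex.exp w := by
    intro w hw
    apply h.inj _ _ (Complex.exp_ne_zero _) (Complex.exp_ne_zero _)
    rw [← h.conj _ (mul_ne_zero hω hw), ← h.conj _ hw, h.mul _ _ hω hw, hωζ,
      hD _ (mul_ne_zero hζ0 (h.nz w hw)), hD _ (h.nz w hw), mul_pow, hprim.pow_eq_one, one_mul]
  have hω1 : ω = 1 := by
    by_contra hne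
    have hne' : ω - 1 ≠ 0 := sub_ne_zero.2 hne
    have h1 := hexp (ω - 1)⁻¹ (inv_ne_zero hne')
    have h2 : ω * (ω - 1)⁻¹ = 1 + (ω - 1)⁻¹ := by field_simp; ring
    rw [h2, Complex.exp_add] at h1
    have h3 : Complex.exp 1 = 1 := mul_right_cancel₀ (Complex.exp_ne_zero _) (by rw [h1, one_mul])
    have h4 := congrArg norm h3
    rw [Complex.norm_exp] at h4
    simp at h4
  rw [hω1, h.one] at hωζ
  rw [← hωζ] at hprim
  have hk1 : k = 1 := hprim.unique IsPrimitiveRoot.one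
  refine ⟨c, hc0, fun w hw => ?_⟩
  rw [← h.conj w hw, hD _ (h.nz w hw), hk1, pow_one]

theorem Sit.inv {φ g : ℂ → ℂ} (h : Sit φ g) :
    Sit (fun z => (φ z)⁻¹) (fun z => (g z⁻¹)⁻¹) where
  one := by simp [h.one]
  mul a z ha hz := by rw [h.mul a z ha hz, mul_inv]
  inj a b ha hb hab := h.inj a b ha hb (inv_injective hab)
  sur z hz := by
    obtain ⟨w, hw, hwz⟩ := h.sur z⁻¹ (inv_ne_zero hz)
    exact ⟨w, hw, by rw [hwz, inv_inv]⟩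
  nz z hz := inv_ne_zero (h.nz z hz)
  dg z hz := by
    have h1 : DifferentiableAt ℂ (fun z => g z⁻¹) z :=
      (h.dg z⁻¹ (inv_ne_zero hz)).comp z (differentiableAt_inv hz)
    exact h1.inv (h.ng _ (inv_ne_zero hz))
  ng z hz := inv_ne_zero (h.ng _ (inv_ne_zero hz))
  conj w hw := by rw [inv_inv, h.conj w hw]

/-- a conjugating mapping of `ℂ*` fixing `1` conjugates `exp` to
`z ↦ exp(c z)` or to `z ↦ exp(c / z)` for some `c ∈ ℂ*`. -/
theorem stmt3 (φ : ℂ → ℂ) (hφ : ConjugatingCstar φ) (h1 : φ 1 = 1) :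
    ∃ c : ℂ, c ≠ 0 ∧
      ((∀ w ∈ Cstar, φ (Complex.exp w) = Complex.exp (c * φ w)) ∨
       (∀ w ∈ Cstar, φ (Complex.exp w) = Complex.exp (c / φ w))) := by
  have hmul := conj_map_mul φ hφ h1
  obtain ⟨hb, hc⟩ := hφ
  obtain ⟨g, hg, hg'⟩ := hc Complex.exp
    ⟨Complex.differentiable_exp.differentiableOn, fun z _ => Complex.exp_ne_zero z⟩
  have hS : Sit φ g :=
    ⟨h1, hmul, fun a b ha hb' hab => hb.injOn ha hb' hab, fun z hz => hb.surjOn hz,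
      fun z hz => hb.mapsTo hz, endo_diff hg, fun z hz => hg.2 hz, hg'⟩
  rcases lt_trichotomy ‖φ 2‖ 1 with h | h | h
  · obtain ⟨c, hc0, hcc⟩ := hS.inv.main (by
      rw [norm_inv]
      exact (one_lt_inv₀ (norm_pos_iff.2 (hS.nz 2 two_ne_zero))).2 h)
    refine ⟨-c, neg_ne_zero.2 hc0, Or.inr fun w hw => ?_⟩
    have := hcc w hw
    rw [inv_eq_iff_eq_inv, ← Complex.exp_neg] at this
    rw [this, neg_div, div_eq_mul_inv]
  · exact absurd h hS.norm_ne_one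
  · obtain ⟨c, hc0, hcc⟩ := hS.main h
    exact ⟨c, hc0, Or.inl hcc⟩
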